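/- arXiv:math/0402454 — 2 statements merged into one kernel-verified Lean document; each statement's English description precedes it below -/
import Mathlib

section
/- There exists a finite set S ⊂ ℂ such that for every λ ∉ S the set of lines on X_λ, i.e. the set of 2-dimensional ℂ-linear subspaces W ⊆ ℂ⁶ on which both F_λ and G_λ vanish identically, has at least 1458 elements (in particular, more than the 1053 lines expected on a generic (3,3) complete intersection Calabi–Yau threefold). -/
noncomputable section

/-- The first cubic form defining the (3,3) pencil `X_λ`. -/
def Fcubic (l : ℂ) (x : Fin 6 → ℂ) : ℂ :=
  x 0 ^ 3 + x 1 ^ 3 + x 2 ^ 3 - 3 * l * x 3 * x 4 * x 5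

/-- The second cubic form defining the (3,3) pencil `X_λ`. -/
def Gcubic (l : ℂ) (x : Fin 6 → ℂ) : ℂ :=
  x 3 ^ 3 + x 4 ^ 3 + x 5 ^ 3 - 3 * l * x 0 * x 1 * x 2

/-- `W` is a line on `X_λ`: a 2-dimensional linear subspace of `ℂ⁶` on which
both cubics vanish identically. -/
def IsLineOn (l : ℂ) (w : Submodule ℂ (Fin 6 → ℂ)) : Prop :=
  Module.finrank ℂ w = 2 ∧ ∀ x ∈ w, Fcubic l x = 0 ∧ Gcubic l x = 0

/-- First spanning vector of the basic lines. -/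
def vs (β γ p q : ℂ) : Fin 6 → ℂ := ![1, β, γ, p, q, 0]

/-- Second spanning vector of the basic lines. -/
def vt (β γ r : ℂ) : Fin 6 → ℂ := ![1, β * β ^ 6, γ * β ^ 3, 0, 0, r]

/-- The basic lines. -/
def Wb (β γ p q r : ℂ) : Submodule ℂ (Fin 6 → ℂ) := Submodule.span ℂ {vs β γ p q, vt β γ r}

lemma mem_Wb {β γ p q r : ℂ} {x : Fin 6 → ℂ} :
    x ∈ Wb β γ p q r ↔ ∃ a b : ℂ, x = ![a + b, β * (a + β ^ 6 * b), γ * (a + β ^ 3 * b),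
      a * p, a * q, b * r] := by
  unfold Wb
  rw [Submodule.mem_span_pair]
  have key : ∀ a b : ℂ, a • vs β γ p q + b • vt β γ r = ![a + b, β * (a + β ^ 6 * b),
      γ * (a + β ^ 3 * b), a * p, a * q, b * r] := by
    intro a b
    ext i
    fin_cases i <;> simp [vs, vt] <;> ring
  simp only [key]
  constructor
  · rintro ⟨a, b, h⟩
    exact ⟨a, b, h.symm⟩
  · rintro ⟨a, b, h⟩
    exact ⟨a, b, h.symm⟩

lemma finrank_Wb {β γ p q r : ℂ} (hp : p ≠ 0) (hr : r ≠ 0) :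
    Module.finrank ℂ (Wb β γ p q r) = 2 := by
  have hli : LinearIndependent ℂ ![vs β γ p q, vt β γ r] := by
    rw [LinearIndependent.pair_iff]
    intro a b h
    have h3 := congrFun h 3
    have h5 := congrFun h 5
    simp [vs, vt] at h3 h5
    exact ⟨h3.resolve_right hp, h5.resolve_right hr⟩
  have := finrank_span_eq_card hli
  rw [Matrix.range_cons, Matrix.range_cons, Matrix.range_empty, Set.union_empty,
    Set.singleton_union] at this
  exact this.trans (by simp)

lemma line_Wb {l β γ p q r : ℂ} (hβ : β ^ 6 + β ^ 3 + 1 = 0) (hγ : γ ^ 3 = β ^ 6)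
    (hl : l * p * q * r = 3) (hpq : p ^ 3 + q ^ 3 = 3 * l * (β * γ))
    (hr : r ^ 3 = 3 * l * (β * γ)) : IsLineOn l (Wb β γ p q r) := by
  have hp0 : p ≠ 0 := by rintro rfl; simp at hl
  have hr0 : r ≠ 0 := by rintro rfl; simp at hl
  refine ⟨finrank_Wb hp0 hr0, ?_⟩
  intro x hx
  obtain ⟨a, b, rfl⟩ := mem_Wb.1 hx
  have h9 : β ^ 9 = 1 := by linear_combination (β ^ 3 - 1) * hβ
  constructor
  · simp only [Fcubic]
    simp
    generalize hw : β ^ 3 = w at *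
    have h6 : β ^ 6 = w ^ 2 := by rw [← hw]; ring
    rw [h6] at hβ hγ ⊢
    have h3 : w ^ 3 = 1 := by rw [← h9, ← hw]; ring
    rw [mul_pow, mul_pow, hw, hγ]
    have e2 : w ^ 2 = - w - 1 := by linear_combination hβ
    have : 3 * l * (a * p) * (a * q) * (b * r) = 9 * a ^ 2 * b := by
      linear_combination 3 * a ^ 2 * b * hl
    rw [this]
    have e1 : w * (a + w ^ 2 * b) ^ 3 = w * a ^ 3 + 3 * a ^ 2 * b + 3 * w ^ 2 * a * b ^ 2 + w * b ^ 3 := by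
      linear_combination (3 * a ^ 2 * b + 3 * w ^ 2 * a * b ^ 2 + w * b ^ 3 * (w ^ 3 + 1)) * h3
    have e3 : w ^ 2 * (a + w * b) ^ 3 = w ^ 2 * a ^ 3 + 3 * a ^ 2 * b + 3 * w * a * b ^ 2 + w ^ 2 * b ^ 3 := by
      linear_combination (3 * a ^ 2 * b + 3 * w * a * b ^ 2 + w ^ 2 * b ^ 3) * h3
    rw [e1, e3]
    linear_combination (a ^ 3 + 3 * a * b ^ 2 + b ^ 3) * hβ
  · simp only [Gcubic]
    simp
    generalize hw : β ^ 3 = w at *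
    have h6 : β ^ 6 = w ^ 2 := by rw [← hw]; ring
    rw [h6] at hβ hγ ⊢
    have h3 : w ^ 3 = 1 := by rw [← h9, ← hw]; ring
    have e : (a + b) * (a + w ^ 2 * b) * (a + w * b) = a ^ 3 + b ^ 3 := by
      linear_combination (a ^ 2 * b + a * b ^ 2) * hβ + (a * b ^ 2 + b ^ 3) * h3
        - (0 : ℂ) * h3
    linear_combination a ^ 3 * hpq + b ^ 3 * hr - 3 * l * (β * γ) * e

/-- On a basic line, `x 3 = 0` forces `x 4 = 0`. -/
lemma prop34 {β γ p q r : ℂ} (hp : p ≠ 0) {x : Fin 6 → ℂ} (hx : x ∈ Wb β γ p q r)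
    (h : x 3 = 0) : x 4 = 0 := by
  obtain ⟨a, b, rfl⟩ := mem_Wb.1 hx
  simp at h ⊢
  left
  exact h.resolve_right hp

/-- The pairs of coordinates that are not proportional on basic lines. -/
def badPair (i j : Fin 6) : Prop :=
  (i = 3 ∧ j = 5) ∨ (i = 4 ∧ j = 5) ∨ (i = 5 ∧ j = 3) ∨ (i = 5 ∧ j = 4) ∨
  (i = 0 ∧ j = 1) ∨ (i = 0 ∧ j = 2) ∨ (i = 1 ∧ j = 2) ∨
  (i = 1 ∧ j = 0) ∨ (i = 2 ∧ j = 0) ∨ (i = 2 ∧ j = 1)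

lemma not_prop {β γ p q r : ℂ} (hβ : β ^ 6 + β ^ 3 + 1 = 0) (hγ : γ ^ 3 = β ^ 6)
    (hp : p ≠ 0) (hq : q ≠ 0) (hr : r ≠ 0) {i j : Fin 6} (hij : badPair i j) :
    ∃ x ∈ Wb β γ p q r, x i = 0 ∧ x j ≠ 0 := by
  have h9 : β ^ 9 = 1 := by linear_combination (β ^ 3 - 1) * hβ
  have hβ0 : β ≠ 0 := by rintro rfl; simp at hβ
  have hγ0 : γ ≠ 0 := by
    rintro rfl
    have : β ^ 6 = 0 := by rw [← hγ]; simp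
    exact hβ0 (by simpa using this)
  have hw1 : β ^ 3 - 1 ≠ 0 := by
    intro h
    have h1 : β ^ 3 = 1 := by linear_combination h
    have h2 : β ^ 6 = 1 := by
      calc β ^ 6 = (β ^ 3) ^ 2 := by ring
        _ = 1 := by rw [h1]; simp
    rw [h1, h2] at hβ
    norm_num at hβ
  have hw2 : β ^ 6 - 1 ≠ 0 := by
    intro h
    apply hw1
    linear_combination h9 - β ^ 3 * h
  have hw3 : β ^ 6 - β ^ 3 ≠ 0 := by
    have : β ^ 6 - β ^ 3 = β ^ 3 * (β ^ 3 - 1) := by ring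
    rw [this]
    exact mul_ne_zero (pow_ne_zero _ hβ0) hw1
  have hm : ∀ a b : ℂ, ![a + b, β * (a + β ^ 6 * b), γ * (a + β ^ 3 * b),
      a * p, a * q, b * r] ∈ Wb β γ p q r := fun a b => mem_Wb.2 ⟨a, b, rfl⟩
  rcases hij with h | h | h | h | h | h | h | h | h | h <;> obtain ⟨rfl, rfl⟩ := h
  · exact ⟨_, hm 0 1, by simp, by simpa using hr⟩
  · exact ⟨_, hm 0 1, by simp, by simpa using hr⟩
  · exact ⟨_, hm 1 0, by simp, by simpa using hp⟩
  · exact ⟨_, hm 1 0, by simp, by simpa using hq⟩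
  · refine ⟨_, hm (-1) 1, by simp, ?_⟩
    have : β * (-1 + β ^ 6 * 1) ≠ 0 :=
      mul_ne_zero hβ0 (by intro h; apply hw2; linear_combination h)
    simpa using this
  · refine ⟨_, hm (-1) 1, by simp, ?_⟩
    have : γ * (-1 + β ^ 3 * 1) ≠ 0 :=
      mul_ne_zero hγ0 (by intro h; apply hw1; linear_combination h)
    simpa using this
  · refine ⟨_, hm (β ^ 6) (-1), by simp, ?_⟩
    have : γ * (β ^ 6 + β ^ 3 * (-1)) ≠ 0 :=
      mul_ne_zero hγ0 (by intro h; apply hw3; linear_combination h)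
    simpa using this
  · refine ⟨_, hm (β ^ 6) (-1), by simp, ?_⟩
    have : (β ^ 6 + (-1)) ≠ 0 := by intro h; apply hw2; linear_combination h
    simpa using this
  · refine ⟨_, hm (β ^ 3) (-1), by simp, ?_⟩
    have : (β ^ 3 + (-1)) ≠ 0 := by intro h; apply hw1; linear_combination h
    simpa using this
  · refine ⟨_, hm (β ^ 3) (-1), by simp, ?_⟩
    have : β * (β ^ 3 + β ^ 6 * (-1)) ≠ 0 :=
      mul_ne_zero hβ0 (by intro h; apply hw3; linear_combination -h)
    simpa using this

/-- The basic line determines its parameters. -/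
lemma Wb_inj {β γ p q r β' γ' p' q' r' : ℂ} (hr' : r' ≠ 0)
    (h : Wb β γ p q r = Wb β' γ' p' q' r') : β = β' ∧ γ = γ' ∧ p = p' ∧ q = q' := by
  have h1 : ![1 + 0, β * (1 + β ^ 6 * 0), γ * (1 + β ^ 3 * 0),
      1 * p, 1 * q, 0 * r] ∈ Wb β' γ' p' q' r' := h ▸ mem_Wb.2 ⟨1, 0, rfl⟩
  obtain ⟨a, b, hab⟩ := mem_Wb.1 h1
  have e5 := congrFun hab 5
  have e0 := congrFun hab 0
  have e1 := congrFun hab 1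
  have e2 := congrFun hab 2
  have e3 := congrFun hab 3
  have e4 := congrFun hab 4
  simp at e0 e1 e2 e3 e4 e5
  have hb : b = 0 := e5.resolve_right hr'
  subst hb
  have ha : a = 1 := by simpa using e0.symm
  subst ha
  simp at e1 e2 e3 e4
  exact ⟨e1, e2, e3, e4⟩

/-- The order-six coordinate symmetry. -/
def g6 : Equiv.Perm (Fin 6) where
  toFun := ![3, 4, 5, 1, 2, 0]
  invFun := ![5, 3, 4, 0, 1, 2]
  left_inv := by decide
  right_inv := by decide

/-- Pull-back of a subspace by a coordinate permutation. -/
def perm (σ : Equiv.Perm (Fin 6)) (W : Submodule ℂ (Fin 6 → ℂ)) : Submodule ℂ (Fin 6 → ℂ) :=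
  W.map ((LinearEquiv.funCongrLeft ℂ ℂ σ).symm : (Fin 6 → ℂ) →ₗ[ℂ] (Fin 6 → ℂ))

lemma mem_perm {σ : Equiv.Perm (Fin 6)} {W : Submodule ℂ (Fin 6 → ℂ)} {x : Fin 6 → ℂ} :
    x ∈ perm σ W ↔ (fun i => x (σ i)) ∈ W := by
  unfold perm
  rw [Submodule.mem_map_equiv]
  rfl

lemma line_perm_one {l : ℂ} {W : Submodule ℂ (Fin 6 → ℂ)} (σ : Equiv.Perm (Fin 6))
    (hσ : ∀ x, (Fcubic l (fun i => x (σ i)) = 0 ∧ Gcubic l (fun i => x (σ i)) = 0) →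
      (Fcubic l x = 0 ∧ Gcubic l x = 0))
    (h : IsLineOn l W) : IsLineOn l (perm σ W) := by
  refine ⟨?_, fun x hx => hσ x (h.2 _ (mem_perm.1 hx))⟩
  rw [← h.1]
  exact LinearEquiv.finrank_map_eq _ _

lemma g6_inv (l : ℂ) (k : ℕ) : ∀ x, (Fcubic l (fun i => x ((g6 ^ k) i)) = 0 ∧
    Gcubic l (fun i => x ((g6 ^ k) i)) = 0) → (Fcubic l x = 0 ∧ Gcubic l x = 0) := by
  induction k with
  | zero => intro x h; simpa using h
  | succ k ih =>
    intro x h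
    apply ih
    have e : ∀ i, (g6 ^ (k + 1)) i = (g6 ^ k) (g6 i) := by
      intro i; rw [pow_succ]; rfl
    simp only [e] at h
    obtain ⟨h1, h2⟩ := h
    simp [Fcubic, Gcubic, g6] at h1 h2 ⊢
    constructor
    · linear_combination h2
    · linear_combination h1

lemma g6_pairs : ∀ k m : Fin 6, k ≠ m →
    badPair ((g6 ^ (m : ℕ))⁻¹ ((g6 ^ (k : ℕ)) 3)) ((g6 ^ (m : ℕ))⁻¹ ((g6 ^ (k : ℕ)) 4)) := by
  unfold badPair
  decide

/-- Exponents of the primitive ninth roots of unity. -/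
def ee : Fin 6 → ℕ := ![1, 2, 4, 5, 7, 8]

lemma ee_facts : (∀ i, ee i < 9) ∧ Function.Injective ee := by
  constructor
  · decide
  · decide

theorem stmt_2 :
    ∃ S : Finset ℂ, ∀ l : ℂ, l ∉ S →
      ∃ T : Finset (Submodule ℂ (Fin 6 → ℂ)),
        1458 ≤ T.card ∧ ∀ w ∈ T, IsLineOn l w := by
  classical
  refine ⟨insert 0 (Polynomial.nthRoots 6 (4 : ℂ)).toFinset, ?_⟩
  intro l hlS
  rw [Finset.mem_insert, Multiset.mem_toFinset, Polynomial.mem_nthRoots (by norm_num)] at hlS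
  push Not at hlS
  obtain ⟨hl0, hl6⟩ := hlS
  -- base constants
  obtain ⟨δ, hδ⟩ := IsAlgClosed.exists_pow_nat_eq (9 * l ^ 2 - 36 / l ^ 4) (n := 2) (by norm_num)
  obtain ⟨r0, hr0⟩ := IsAlgClosed.exists_pow_nat_eq (3 * l) (n := 3) (by norm_num)
  obtain ⟨p0, hp0⟩ := IsAlgClosed.exists_pow_nat_eq ((3 * l + δ) / 2) (n := 3) (by norm_num)
  have hAB : (3 * l + δ) / 2 * ((3 * l - δ) / 2) = 9 / l ^ 4 := by
    linear_combination (-1 / 4) * hδ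
  have hδ0 : δ ≠ 0 := by
    rintro rfl
    field_simp at hδ
    apply hl6
    linear_combination (-1 / 9) * hδ
  have h9l : (9 / l ^ 4 : ℂ) ≠ 0 := div_ne_zero (by norm_num) (pow_ne_zero _ hl0)
  have hA0 : (3 * l + δ) / 2 ≠ 0 := left_ne_zero_of_mul (hAB ▸ h9l)
  have hr00 : r0 ≠ 0 := by
    rintro rfl
    apply hl0
    linear_combination (-1 / 3) * hr0
  have hp00 : p0 ≠ 0 := by
    rintro rfl
    apply hA0
    rw [← hp0]; simp
  obtain ⟨q0, hq0⟩ : ∃ q0 : ℂ, l * p0 * q0 * r0 = 3 := ⟨3 / (l * p0 * r0), by field_simp⟩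
  have hq00 : q0 ≠ 0 := by rintro rfl; simp at hq0
  have hq3 : q0 ^ 3 = (3 * l - δ) / 2 := by
    have h1 : l ^ 3 * ((3 * l + δ) / 2) * q0 ^ 3 * (3 * l) = 27 := by
      rw [← hp0, ← hr0]
      linear_combination ((l * p0 * q0 * r0) ^ 2 + 3 * (l * p0 * q0 * r0) + 9) * hq0
    have h2 : l ^ 3 * ((3 * l + δ) / 2) * ((3 * l - δ) / 2) * (3 * l) = 27 := by
      have : l ^ 4 * (9 / l ^ 4) = 9 := by field_simp
      linear_combination 3 * l ^ 4 * hAB + 3 * this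
    have hne : l ^ 3 * ((3 * l + δ) / 2) * (3 * l) ≠ 0 := by
      refine mul_ne_zero (mul_ne_zero (pow_ne_zero _ hl0) hA0) (mul_ne_zero (by norm_num) hl0)
    apply mul_left_cancel₀ hne
    linear_combination h1 - h2
  have hsum : p0 ^ 3 + q0 ^ 3 = 3 * l := by rw [hp0, hq3]; ring
  have hdiff : p0 ^ 3 ≠ q0 ^ 3 := by
    rw [hp0, hq3]
    intro h
    apply hδ0
    linear_combination h
  obtain ⟨ζ, hζ⟩ : ∃ ζ : ℂ, IsPrimitiveRoot ζ 9 :=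
    ⟨_, Complex.isPrimitiveRoot_exp 9 (by norm_num)⟩
  have hζ9 : ζ ^ 9 = 1 := hζ.pow_eq_one
  have hζ0 : ζ ≠ 0 := hζ.ne_zero (by norm_num)
  have hζm : ∀ n : ℕ, ζ ^ n = ζ ^ (n % 9) := fun n => by
    conv_lhs => rw [← Nat.div_add_mod n 9, pow_add, pow_mul, hζ9, one_pow, one_mul]
  have hζ6 : ζ ^ 6 + ζ ^ 3 + 1 = 0 := by
    have h3 : ζ ^ 3 - 1 ≠ 0 := by
      intro h
      have : ζ ^ 3 = 1 := by linear_combination h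
      have := hζ.dvd_of_pow_eq_one 3 this
      omega
    apply mul_left_cancel₀ h3
    linear_combination hζ9
  -- parameter functions
  let cc : Bool → ℂ := fun c => if c then p0 else q0
  let B : Fin 6 → ℂ := fun e => ζ ^ ee e
  let Γ : Fin 6 → Fin 9 → ℂ := fun e a => ζ ^ (3 * (a : ℕ) + 8 * ee e)
  let P : Fin 9 → Bool → ℂ := fun a c => ζ ^ (a : ℕ) * cc c
  let Q : Fin 9 → Fin 3 → Bool → ℂ := fun a k c => ζ ^ ((a : ℕ) + 3 * (k : ℕ)) * cc (!c)
  let R : Fin 9 → Fin 3 → ℂ := fun a k => ζ ^ (7 * (a : ℕ) + 6 * (k : ℕ)) * r0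
  have hcc0 : ∀ c, cc c ≠ 0 := by intro c; cases c <;> simp [cc, hp00, hq00]
  have hP0 : ∀ a c, P a c ≠ 0 := fun a c => mul_ne_zero (pow_ne_zero _ hζ0) (hcc0 _)
  have hQ0 : ∀ a k c, Q a k c ≠ 0 := fun a k c => mul_ne_zero (pow_ne_zero _ hζ0) (hcc0 _)
  have hR0 : ∀ a k, R a k ≠ 0 := fun a k => mul_ne_zero (pow_ne_zero _ hζ0) hr00
  have hz : ∀ n : ℕ, ζ ^ (9 * n) = 1 := fun n => by rw [pow_mul, hζ9, one_pow]
  have hB : ∀ e, B e ^ 6 + B e ^ 3 + 1 = 0 := by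
    intro e
    have h36 : ∀ n, B e ^ n = ζ ^ ((ee e * n) % 9) := fun n => by
      simp only [B]; rw [← pow_mul, hζm]
    rw [h36, h36]
    fin_cases e <;> simp [ee] <;> first | linear_combination hζ6
  have hΓ : ∀ e a, Γ e a ^ 3 = B e ^ 6 := by
    intro e a
    simp only [Γ, B]
    rw [← pow_mul, ← pow_mul, show (3 * (a : ℕ) + 8 * ee e) * 3
      = 9 * (a + 2 * ee e) + ee e * 6 by ring, pow_add, hz, one_mul]
  have hBΓ : ∀ e a, B e * Γ e a = ζ ^ (3 * (a : ℕ)) := by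
    intro e a
    simp only [Γ, B]
    rw [← pow_add, show ee e + (3 * (a : ℕ) + 8 * ee e) = 9 * ee e + 3 * a by ring, pow_add, hz,
      one_mul]
  have hcprod : ∀ c, l * cc c * cc (!c) * r0 = 3 := by
    intro c
    cases c <;> simp [cc] <;> linear_combination hq0
  have hcsum : ∀ c, cc c ^ 3 + cc (!c) ^ 3 = 3 * l := by
    intro c
    cases c <;> simp [cc] <;> linear_combination hsum
  have hline : ∀ e a k c, IsLineOn l (Wb (B e) (Γ e a) (P a c) (Q a k c) (R a k)) := by
    intro e a k c
    apply line_Wb (hB e) (hΓ e a)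
    · simp only [P, Q, R]
      have : ζ ^ (a : ℕ) * ζ ^ ((a : ℕ) + 3 * (k : ℕ)) * ζ ^ (7 * (a : ℕ) + 6 * (k : ℕ)) = 1 := by
        rw [← pow_add, ← pow_add, ← hz (a + k)]
        congr 1
        ring
      linear_combination (l * cc c * cc (!c) * r0) * this + hcprod c
    · rw [hBΓ]
      simp only [P, Q]
      have : (ζ ^ ((a : ℕ) + 3 * (k : ℕ))) ^ 3 = ζ ^ (3 * (a : ℕ)) := by
        rw [← pow_mul, show ((a : ℕ) + 3 * (k : ℕ)) * 3 = 9 * k + 3 * a by ring, pow_add, hz,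
          one_mul]
      rw [mul_pow, mul_pow, this, ← pow_mul, mul_comm (a : ℕ) 3]
      linear_combination ζ ^ (3 * (a : ℕ)) * hcsum c
    · rw [hBΓ]
      simp only [R]
      rw [mul_pow, ← pow_mul, show (7 * (a : ℕ) + 6 * (k : ℕ)) * 3
        = 9 * (2 * a + 2 * k) + 3 * a by ring, pow_add, hz, hr0]
      ring
  let Φ : Fin 6 × Fin 6 × Fin 9 × Fin 3 × Bool → Submodule ℂ (Fin 6 → ℂ) :=
    fun t => perm (g6 ^ (t.1 : ℕ)) (Wb (B t.2.1) (Γ t.2.1 t.2.2.1) (P t.2.2.1 t.2.2.2.2)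
      (Q t.2.2.1 t.2.2.2.1 t.2.2.2.2) (R t.2.2.1 t.2.2.2.1))
  have hΦ : Function.Injective Φ := by
    rintro ⟨m, e, a, k, c⟩ ⟨m', e', a', k', c'⟩ h
    simp only [Φ] at h
    have hm : m = m' := by
      by_contra hne
      obtain ⟨y, hy, hy1, hy2⟩ := not_prop (hB e') (hΓ e' a') (hP0 a' c') (hQ0 a' k' c')
        (hR0 a' k') (g6_pairs m m' hne)
      have h1 : (fun i => y ((g6 ^ (m' : ℕ))⁻¹ i)) ∈ perm (g6 ^ (m : ℕ))
          (Wb (B e) (Γ e a) (P a c) (Q a k c) (R a k)) := by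
        rw [h, mem_perm]
        simpa using hy
      rw [mem_perm] at h1
      exact hy2 (prop34 (hP0 a c) h1 hy1)
    subst hm
    have h' : Wb (B e) (Γ e a) (P a c) (Q a k c) (R a k)
        = Wb (B e') (Γ e' a') (P a' c') (Q a' k' c') (R a' k') :=
      Submodule.map_injective_of_injective (LinearEquiv.injective _) h
    obtain ⟨h1, h2, h3, h4⟩ := Wb_inj (hR0 a' k') h'
    have he : e = e' := ee_facts.2 (hζ.pow_inj (ee_facts.1 _) (ee_facts.1 _) h1)
    subst he
    have h5 : ζ ^ (3 * (a : ℕ)) = ζ ^ (3 * (a' : ℕ)) := by rw [← hBΓ e a, ← hBΓ e a', h2]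
    have hc3 : cc c ^ 3 = cc c' ^ 3 := by
      have h6 : P a c ^ 3 = P a' c' ^ 3 := by rw [h3]
      simp only [P] at h6
      rw [mul_pow, mul_pow, ← pow_mul, ← pow_mul, mul_comm (a : ℕ) 3, mul_comm (a' : ℕ) 3, ← h5] at h6
      exact mul_left_cancel₀ (pow_ne_zero _ hζ0) h6
    have hcc : c = c' := by
      cases c <;> cases c' <;> simp [cc] at hc3 ⊢
      · exact hdiff hc3.symm
      · exact hdiff hc3
    subst hcc
    have ha : a = a' := Fin.ext (hζ.pow_inj a.2 a'.2 (mul_right_cancel₀ (hcc0 c) h3))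
    subst ha
    have hk : k = k' := by
      have h7 := mul_right_cancel₀ (hcc0 (!c)) h4
      rw [pow_add, pow_add] at h7
      have h8 := hζ.pow_inj (by omega) (by omega) (mul_left_cancel₀ (pow_ne_zero _ hζ0) h7)
      apply Fin.ext
      omega
    subst hk
    rfl
  refine ⟨Finset.univ.image Φ, ?_, ?_⟩
  · rw [Finset.card_image_of_injective _ hΦ]
    simp
  · intro w hw
    obtain ⟨t, -, rfl⟩ := Finset.mem_image.1 hw
    exact line_perm_one _ (g6_inv l _) (hline _ _ _ _)
end
end

section
/- Let A = ℂ[x,y] be the polynomial ring in two variables over ℂ. Then the kernel of any A-linear map between finitely generated free A-modules is itself a finitely generated free A-module. -/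
noncomputable section

/-- `A = ℂ[x,y]`, the polynomial ring in two variables over `ℂ`. -/
abbrev PolyA : Type := MvPolynomial (Fin 2) ℂ

open Polynomial in
/-- `p` is nonzero and `A/p` is `ℂ[X]`, with a ring section `ℂ[X] → A`. -/
def GoodElt {A : Type} [CommRing A] (p : A) : Prop :=
  p ≠ 0 ∧ ∃ (ε : A →+* ℂ[X]) (σ : ℂ[X] →+* A), (∀ b, ε (σ b) = b) ∧ ∀ a, ε a = 0 ↔ p ∣ a

/-- Elementary modification step. -/
theorem good_step {A K : Type} [CommRing A] [IsDomain A] [AddCommGroup K] [Module A K]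
    [Module.IsTorsionFree A K] {p : A} (hp : GoodElt p)
    (H : ∀ (a : A) (k k' : K), a • k = p • k' → p ∣ a ∨ ∃ m, k = p • m)
    {r : ℕ} (b : Fin r → K) (hb : LinearIndependent A b) (c : Fin r → A) (k : K)
    (hc : ∑ i, c i • b i = p • k) (i₀ : Fin r) (hi₀ : ¬ p ∣ c i₀) :
    ∃ b' : Fin r → K, LinearIndependent A b' ∧
      Submodule.span A (Set.range b) < Submodule.span A (Set.range b') := by
  obtain ⟨hp0, ε, σ, hεσ, hε⟩ := hp
  -- the relation module
  let L : Submodule (Polynomial ℂ) (Fin r → Polynomial ℂ) :=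
    { carrier := {v | ∃ m : K, ∑ i, σ (v i) • b i = p • m}
      zero_mem' := ⟨0, by simp⟩
      add_mem' := by
        rintro v w ⟨m, hm⟩ ⟨n, hn⟩
        exact ⟨m + n, by simp [add_smul, Finset.sum_add_distrib, hm, hn]⟩
      smul_mem' := by
        rintro a v ⟨m, hm⟩
        refine ⟨σ a • m, ?_⟩
        rw [smul_comm, ← hm, Finset.smul_sum]
        simp [mul_smul] }
  have hv : (fun i => ε (c i)) ∈ L := by
    have h1 : ∀ i, ∃ d, c i - σ (ε (c i)) = p * d := fun i => by
      have : p ∣ c i - σ (ε (c i)) := (hε _).1 (by simp [hεσ])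
      exact this
    choose d hd using h1
    refine ⟨k - ∑ i, d i • b i, ?_⟩
    rw [smul_sub, ← hc, Finset.smul_sum, ← Finset.sum_sub_distrib]
    refine Finset.sum_congr rfl fun i _ => ?_
    rw [← mul_smul, ← hd, sub_smul, sub_sub_cancel]
  obtain ⟨n, S⟩ := Submodule.smithNormalForm (Pi.basisFun (Polynomial ℂ) (Fin r)) L
  obtain ⟨bM, bN, f, a, ha⟩ := S
  have hn : Nonempty (Fin n) := by
    by_contra hne
    rw [not_nonempty_iff] at hne
    have h0 : (⟨_, hv⟩ : L) = 0 := by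
      rw [← bN.sum_repr ⟨_, hv⟩]; simp
    have h1 := congrFun (congrArg Subtype.val h0) i₀
    exact hi₀ ((hε _).1 h1)
  obtain ⟨j⟩ := hn
  have haj : a j ≠ 0 := by
    intro h0
    have := ha j
    rw [h0, zero_smul] at this
    exact bN.ne_zero j (Subtype.ext this)
  have hL : ∃ m : K, ∑ i, σ (bM (f j) i) • b i = p • m := by
    obtain ⟨m, hm⟩ := (ha j ▸ (bN j).2 : a j • bM (f j) ∈ L)
    have h2 : σ (a j) • (∑ i, σ (bM (f j) i) • b i) = p • m := by
      rw [← hm, Finset.smul_sum]; simp [mul_smul]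
    rcases H _ _ _ h2 with h | h
    · rw [← hε, hεσ] at h; exact absurd h haj
    · exact h
  obtain ⟨m, hm⟩ := hL
  -- change of basis
  let P := ((Pi.basisFun (Polynomial ℂ) (Fin r)).toMatrix bM).map σ
  let Q := (bM.toMatrix (Pi.basisFun (Polynomial ℂ) (Fin r))).map σ
  have hPQ : P * Q = 1 := by
    simp only [P, Q]
    rw [← Matrix.map_mul, Module.Basis.toMatrix_mul_toMatrix_flip]; simp
  have hQP : Q * P = 1 := by
    simp only [P, Q]
    rw [← Matrix.map_mul, Module.Basis.toMatrix_mul_toMatrix_flip]; simp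
  let E := Matrix.toLin'OfInv hQP hPQ
  let bs := Module.Basis.span hb
  let nb : Module.Basis (Fin r) A (Submodule.span A (Set.range b)) :=
    (Pi.basisFun A (Fin r)).map (E.trans bs.equivFun.symm)
  have hnb : ∀ i, (nb i : K) = ∑ l, σ (bM i l) • b l := by
    intro i
    simp [nb, E, bs, Module.Basis.equivFun_symm_apply, P, Module.Basis.span_apply,
      Module.Basis.toMatrix_apply]
  have hnbj : (nb (f j) : K) = p • m := by rw [hnb, hm]
  let b' : Fin r → K := Function.update (fun i => (nb i : K)) (f j) m
  have hb'j : p • b' (f j) = nb (f j) := by simp [b', hnbj]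
  have hb'i : ∀ i, i ≠ f j → b' i = nb i := fun i hi => by simp [b', hi]
  have hmem : ∀ i, (nb i : K) ∈ Submodule.span A (Set.range b') := by
    intro i
    by_cases hi : i = f j
    · rw [hi, ← hb'j]
      exact Submodule.smul_mem _ _ (Submodule.subset_span ⟨_, rfl⟩)
    · rw [← hb'i i hi]; exact Submodule.subset_span ⟨_, rfl⟩
  have hnbli : LinearIndependent A (fun i => (nb i : K)) :=
    nb.linearIndependent.map' (Submodule.subtype _) (Submodule.ker_subtype _)
  refine ⟨b', ?_, ?_⟩
  · rw [Fintype.linearIndependent_iff] at hnbli ⊢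
    intro g hg
    have h1 : ∑ i, (if i = f j then g i else p * g i) • (nb i : K) = 0 := by
      have : ∑ i, p • g i • b' i = 0 := by rw [← Finset.smul_sum, hg, smul_zero]
      rw [← this]
      refine Finset.sum_congr rfl fun i _ => ?_
      split_ifs with h
      · subst h; rw [smul_comm, hb'j]
      · rw [hb'i i h, mul_smul]
    intro i
    have := hnbli _ h1 i
    split_ifs at this with h
    · exact this
    · exact (mul_eq_zero.1 this).resolve_left hp0
  · refine lt_of_le_of_ne ?_ ?_
    · intro x hx
      have h1 := nb.sum_repr ⟨x, hx⟩
      have h2 := congrArg Subtype.val h1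
      simp only [Submodule.coe_sum, Submodule.coe_smul] at h2
      rw [← h2]
      exact Submodule.sum_mem _ fun i _ => Submodule.smul_mem _ _ (hmem i)
    · intro heq
      have hmm : m ∈ Submodule.span A (Set.range b) := by
        rw [heq]; exact Submodule.subset_span ⟨f j, by simp [b']⟩
      have h1 : p • (⟨m, hmm⟩ : Submodule.span A (Set.range b)) = nb (f j) :=
        Subtype.ext hnbj.symm
      have h2 := congrArg (fun x => nb.repr x (f j)) h1
      simp only [map_smul, Finsupp.smul_apply, Module.Basis.repr_self, Finsupp.single_eq_same,
        smul_eq_mul] at h2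
      have h3 : ε p = 0 := (hε p).2 dvd_rfl
      have h4 := congrArg ε h2
      simp [h3] at h4

/-- Freeness from a free lattice after inverting products of good elements. -/
theorem good_free {A K : Type} [CommRing A] [IsDomain A] [AddCommGroup K] [Module A K]
    [Module.IsTorsionFree A K] [IsNoetherian A K] (G : Set A) (hG : ∀ p ∈ G, GoodElt p)
    (H : ∀ p ∈ G, ∀ (a : A) (k k' : K), a • k = p • k' → p ∣ a ∨ ∃ m, k = p • m)
    {r : ℕ} (b₀ : Fin r → K) (hb₀ : LinearIndependent A b₀)
    (hs : ∀ k : K, ∃ s : Multiset A, (∀ p ∈ s, p ∈ G) ∧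
      s.prod • k ∈ Submodule.span A (Set.range b₀)) : Module.Free A K := by
  let 𝒮 : Set (Submodule A K) := {F | ∃ b : Fin r → K, LinearIndependent A b ∧
    F = Submodule.span A (Set.range b) ∧ Submodule.span A (Set.range b₀) ≤ F}
  obtain ⟨F, ⟨b, hb, rfl, hle⟩, hmax⟩ :=
    WellFounded.has_min (wellFounded_gt : WellFounded ((· > ·) : Submodule A K → _ → Prop)) 𝒮
      ⟨_, b₀, hb₀, rfl, le_rfl⟩
  have key : ∀ p ∈ G, ∀ (k : K), p • k ∈ Submodule.span A (Set.range b) →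
      k ∈ Submodule.span A (Set.range b) := by
    intro p hp k hk
    obtain ⟨c, hc⟩ := (Submodule.mem_span_range_iff_exists_fun A).1 hk
    have hdiv : ∀ i, p ∣ c i := by
      by_contra hcon
      push Not at hcon
      obtain ⟨i, hi⟩ := hcon
      obtain ⟨b', hb', hlt⟩ := good_step (hG p hp) (H p hp) b hb c k hc i hi
      exact hmax _ ⟨b', hb', rfl, hle.trans hlt.le⟩ hlt
    choose d hd using hdiv
    have h1 : p • k = p • ∑ i, d i • b i := by
      rw [← hc, Finset.smul_sum]
      refine Finset.sum_congr rfl fun i _ => ?_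
      rw [hd i, mul_smul]
    have h2 := smul_right_injective K (hG p hp).1 h1
    rw [h2]
    exact Submodule.sum_mem _ fun i _ => Submodule.smul_mem _ _ (Submodule.subset_span ⟨i, rfl⟩)
  have key2 : ∀ s : Multiset A, (∀ p ∈ s, p ∈ G) → ∀ k : K,
      s.prod • k ∈ Submodule.span A (Set.range b) → k ∈ Submodule.span A (Set.range b) := by
    intro s
    induction s using Multiset.induction_on with
    | empty => intro _ k hk; simpa using hk
    | cons p s ih =>
      intro hs k hk
      rw [Multiset.prod_cons, mul_smul] at hk
      exact ih (fun q hq => hs q (Multiset.mem_cons_of_mem hq)) k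
        (key p (hs p (Multiset.mem_cons_self _ _)) _ hk)
  have htop : ⊤ ≤ Submodule.span A (Set.range b) := by
    intro k _
    obtain ⟨s, hs1, hs2⟩ := hs k
    exact key2 s hs1 k (hle hs2)
  exact Module.Free.of_basis (Module.Basis.mk hb htop)

/-- A free lattice exists if a localization is a PID. -/
theorem exists_lattice {A K : Type} [CommRing A] [IsDomain A] [AddCommGroup K] [Module A K]
    [Module.IsTorsionFree A K] [Module.Finite A K] (S : Submonoid A) (hS : S ≤ nonZeroDivisors A)
    [IsPrincipalIdealRing (Localization S)] :
    ∃ (r : ℕ) (b : Fin r → K), LinearIndependent A b ∧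
      ∀ k : K, ∃ s ∈ S, s • k ∈ Submodule.span A (Set.range b) := by
  haveI : IsDomain (Localization S) := IsLocalization.isDomain_localization hS
  haveI : Module.Finite (Localization S) (LocalizedModule S K) :=
    Module.Finite.of_isLocalizedModule S (LocalizedModule.mkLinearMap S K)
  obtain ⟨r, bT⟩ := Module.basisOfFiniteTypeTorsionFree' (R := Localization S)
    (M := LocalizedModule S K)
  have h1 : ∀ i, ∃ (s : S) (k : K), s • bT i = LocalizedModule.mkLinearMap S K k := fun i => by
    obtain ⟨⟨k, s⟩, h⟩ := IsLocalizedModule.surj S (LocalizedModule.mkLinearMap S K) (bT i)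
    exact ⟨s, k, h⟩
  choose s b hsb using h1
  have hinj : Function.Injective (LocalizedModule.mkLinearMap S K) := by
    intro x y hxy
    obtain ⟨c, hc⟩ := (IsLocalizedModule.eq_iff_exists S (LocalizedModule.mkLinearMap S K)).1 hxy
    exact smul_right_injective K (nonZeroDivisors.ne_zero (hS c.2)) hc
  have hAinj : Function.Injective (algebraMap A (Localization S)) :=
    IsLocalization.injective _ hS
  let u : Fin r → (Localization S)ˣ := fun i =>
    (IsLocalization.map_units (Localization S) (s i)).unit
  let bU := bT.unitsSMul u
  have hbU : ∀ i, bU i = LocalizedModule.mkLinearMap S K (b i) := by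
    intro i
    rw [← hsb, Module.Basis.unitsSMul_apply]
    change (algebraMap A (Localization S) (s i)) • bT i = (s i : A) • bT i
    rw [algebraMap_smul]
  refine ⟨r, b, ?_, ?_⟩
  · rw [Fintype.linearIndependent_iff]
    intro g hg i
    have h2 : ∑ i, algebraMap A (Localization S) (g i) • bU i = 0 := by
      have := congrArg (LocalizedModule.mkLinearMap S K) hg
      simpa only [map_sum, map_smul, map_zero, hbU, algebraMap_smul] using this
    have h3 := Fintype.linearIndependent_iff.1 bU.linearIndependent _ h2 i
    exact hAinj (by rw [h3, map_zero])
  · intro k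
    obtain ⟨t, ht⟩ := IsLocalization.exist_integer_multiples_of_finite S
      (fun i => bU.repr (LocalizedModule.mkLinearMap S K k) i)
    choose n hn using ht
    refine ⟨t, t.2, ?_⟩
    have : (t : A) • k = ∑ i, n i • b i := by
      apply hinj
      rw [map_smul, map_sum, ← bU.sum_repr (LocalizedModule.mkLinearMap S K k), Finset.smul_sum]
      refine Finset.sum_congr rfl fun i _ => ?_
      rw [map_smul, ← hbU, ← algebraMap_smul (Localization S) (n i), hn, smul_assoc]
    rw [this]
    exact Submodule.sum_mem _ fun i _ => Submodule.smul_mem _ _ (Submodule.subset_span ⟨i, rfl⟩)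

theorem good_prime {A : Type} [CommRing A] {p : A} (hp : GoodElt p) : Prime p := by
  obtain ⟨hp0, ε, σ, hεσ, hε⟩ := hp
  refine ⟨hp0, ?_, ?_⟩
  · intro h
    have := h.map ε
    rw [(hε p).2 dvd_rfl] at this
    exact not_isUnit_zero this
  · intro a b h
    rw [← hε, map_mul, mul_eq_zero] at h
    rwa [hε, hε] at h

theorem good_ker {A M N : Type} [CommRing A] [IsDomain A] [AddCommGroup M] [Module A M]
    [Module.Free A M] [AddCommGroup N] [Module A N] [Module.Free A N] (f : M →ₗ[A] N)
    {p : A} (hp : GoodElt p) (a : A) (k k' : LinearMap.ker f) (h : a • k = p • k') :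
    p ∣ a ∨ ∃ m, k = p • m := by
  by_cases hpa : p ∣ a
  · exact Or.inl hpa
  right
  let b := Module.Free.chooseBasis A M
  have h1 : ∀ i, p ∣ b.repr (k : M) i := by
    intro i
    have := congrArg (fun x : LinearMap.ker f => b.repr (x : M) i) h
    simp at this
    exact ((good_prime hp).dvd_or_dvd (Dvd.intro _ this.symm)).resolve_left hpa
  choose d hd using h1
  have hm : (k : M) = p • ∑ i ∈ (b.repr (k : M)).support, d i • b i := by
    conv_lhs => rw [← b.linearCombination_repr (k : M)]
    rw [Finsupp.linearCombination_apply, Finsupp.sum, Finset.smul_sum]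
    refine Finset.sum_congr rfl fun i _ => ?_
    rw [← mul_smul, ← hd]
  refine ⟨⟨∑ i ∈ (b.repr (k : M)).support, d i • b i, ?_⟩, Subtype.ext hm⟩
  have h2 := k.2
  rw [LinearMap.mem_ker, hm, map_smul, smul_eq_zero] at h2
  exact LinearMap.mem_ker.2 (h2.resolve_left hp.1)

open Polynomial in
theorem good_X_sub (a : ℂ) : GoodElt (C (X - C a) : ℂ[X][X]) := by
  refine ⟨C_ne_zero.2 (X_sub_C_ne_zero a), mapRingHom (evalRingHom a), mapRingHom C, ?_, ?_⟩
  · intro b; ext; simp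
  · intro q
    rw [C_dvd_iff_dvd_coeff, Polynomial.ext_iff]
    simp [dvd_iff_isRoot]

theorem good_equiv {A B : Type} [CommRing A] [CommRing B] (e : A ≃+* B) {p : B}
    (hp : GoodElt p) : GoodElt (e.symm p) := by
  obtain ⟨hp0, ε, σ, hεσ, hε⟩ := hp
  refine ⟨by simpa using hp0, ε.comp e.toRingHom, e.symm.toRingHom.comp σ, ?_, ?_⟩
  · intro b; simp [hεσ]
  · intro a
    rw [← map_dvd_iff e]
    simp [hε]

open Polynomial in
theorem free_ker_of_equiv {A M N : Type} [CommRing A] [IsDomain A] [IsNoetherianRing A]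
    (e : A ≃+* ℂ[X][X]) [AddCommGroup M] [Module A M]
    [Module.Free A M] [Module.Finite A M] [AddCommGroup N] [Module A N] [Module.Free A N]
    (f : M →ₗ[A] N) : Module.Free A (LinearMap.ker f) := by
  letI : Algebra ℂ[X][X] (RatFunc ℂ)[X] := Polynomial.algebra _ _
  let S₀ : Submonoid ℂ[X][X] := (nonZeroDivisors ℂ[X]).map (C : ℂ[X] →+* ℂ[X][X])
  haveI : IsLocalization S₀ (RatFunc ℂ)[X] := Polynomial.isLocalization _ _
  let S : Submonoid A := S₀.comap e
  have hS : S ≤ nonZeroDivisors A := by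
    rintro s ⟨q, hq, hqs⟩
    rw [mem_nonZeroDivisors_iff_ne_zero]
    rintro rfl
    have hq0 : q = 0 := by simpa using hqs
    exact nonZeroDivisors.ne_zero hq hq0
  haveI : IsPrincipalIdealRing (Localization S) := by
    let e2 : Localization S ≃+* (RatFunc ℂ)[X] := IsLocalization.ringEquivOfRingEquiv (M := S) (T := S₀) _ _ e
      (Submonoid.map_comap_eq_of_surjective e.surjective S₀)
    exact IsPrincipalIdealRing.of_surjective e2.symm.toRingHom e2.symm.surjective
  obtain ⟨r, b, hb, hk⟩ := exists_lattice (K := LinearMap.ker f) S hS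
  let G : Set A := Set.range fun a : ℂ => e.symm (C (X - C a))
  have hG : ∀ p ∈ G, GoodElt p := by
    rintro _ ⟨a, rfl⟩
    exact good_equiv e (good_X_sub a)
  refine good_free G hG (fun p hp => good_ker f (hG p hp)) b hb ?_
  intro k
  obtain ⟨s, ⟨q, hq, hqs⟩, hsk⟩ := hk k
  have hq0 : q ≠ 0 := nonZeroDivisors.ne_zero hq
  refine ⟨q.roots.map fun a => e.symm (C (X - C a)), ?_, ?_⟩
  · intro p hp
    obtain ⟨a, _, rfl⟩ := Multiset.mem_map.1 hp
    exact ⟨a, rfl⟩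
  · have hsp := (IsAlgClosed.splits q).eq_prod_roots
    have hs : s = e.symm (C (C q.leadingCoeff)) *
        (q.roots.map fun a => e.symm (C (X - C a))).prod := by
      have h1 : s = e.symm (C q) := by
        rw [RingEquiv.eq_symm_apply]; exact hqs.symm
      rw [h1]
      conv_lhs => rw [hsp]
      rw [map_mul, map_mul, map_multiset_prod, map_multiset_prod, Multiset.map_map,
        Multiset.map_map]
      rfl
    have h3 : e.symm (C (C q.leadingCoeff⁻¹)) * s =
        (q.roots.map fun a => e.symm (C (X - C a))).prod := by
      rw [hs, ← mul_assoc, ← map_mul, ← map_mul, ← map_mul,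
        inv_mul_cancel₀ (leadingCoeff_ne_zero.2 hq0)]
      simp
    rw [← h3, mul_smul]
    exact Submodule.smul_mem _ _ hsk

theorem stmt_9 (M N : Type) [AddCommGroup M] [Module PolyA M]
    [Module.Free PolyA M] [Module.Finite PolyA M]
    [AddCommGroup N] [Module PolyA N] [Module.Free PolyA N] [Module.Finite PolyA N]
    (f : M →ₗ[PolyA] N) :
    Module.Free PolyA (LinearMap.ker f) ∧ Module.Finite PolyA (LinearMap.ker f) := by
  refine ⟨?_, inferInstance⟩
  have e : PolyA ≃+* Polynomial (Polynomial ℂ) :=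
    (MvPolynomial.finSuccEquiv ℂ 1).toRingEquiv.trans
      (Polynomial.mapEquiv (MvPolynomial.uniqueAlgEquiv ℂ (Fin 1)).toRingEquiv)
  exact free_ker_of_equiv e f
end
end
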